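/- For every integer j ≥ 0 the integrals below converge absolutely and ∫₀^∞ (φ_j'(x)² − ((n − 2)/x² + 1/2) φ_j(x)²) w(x) dx = λ_j ∫₀^∞ φ_j(x)² w(x) dx. -/

import Mathlib

open Set MeasureTheory

open Polynomial in
/-- The polynomial `M(-j, b; X)`. -/
noncomputable def kummerPoly (j : ℕ) (b : ℝ) : ℝ[X] :=
  ∑ m ∈ Finset.range (j + 1),
    monomial m ((-1 : ℝ) ^ m * (j.choose m : ℝ) / ∏ k ∈ Finset.range m, (b + (k : ℝ)))

theorem kummerPoly_coeff (j : ℕ) (b : ℝ) (m : ℕ) :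
    (kummerPoly j b).coeff m =
      (-1 : ℝ) ^ m * (j.choose m : ℝ) / ∏ k ∈ Finset.range m, (b + (k : ℝ)) := by
  simp only [kummerPoly, Polynomial.finsetSum_coeff, Polynomial.coeff_monomial,
    Finset.sum_ite_eq', Finset.mem_range]
  split_ifs with h
  · rfl
  · rw [Nat.choose_eq_zero_of_lt (by omega)]
    simp

theorem kummerPoly_coeff_succ (j : ℕ) {b : ℝ} (hb : 0 < b) (m : ℕ) :
    ((m : ℝ) + 1) * (b + m) * (kummerPoly j b).coeff (m + 1) =
      ((m : ℝ) - j) * (kummerPoly j b).coeff m := by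
  have hp : ∏ k ∈ Finset.range m, (b + (k : ℝ)) ≠ 0 :=
    Finset.prod_ne_zero_iff.mpr fun k _ => by positivity
  have hm : b + (m : ℝ) ≠ 0 := by positivity
  have hc : (j.choose (m + 1) : ℝ) * ((m : ℝ) + 1) = (j.choose m : ℝ) * ((j : ℝ) - m) := by
    rcases le_or_gt m j with h | h
    · have := Nat.choose_succ_right_eq j m
      rw [← Nat.cast_sub h]
      exact_mod_cast this
    · rw [Nat.choose_eq_zero_of_lt h, Nat.choose_eq_zero_of_lt (by omega)]
      simp
  rw [kummerPoly_coeff, kummerPoly_coeff, Finset.prod_range_succ]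
  field_simp
  rw [pow_succ]
  linear_combination (-(-1 : ℝ) ^ m) * hc

open Polynomial in
/-- Kummer's differential equation. -/
theorem kummerPoly_ode (j : ℕ) {b : ℝ} (hb : 0 < b) (s : ℝ) :
    s * (derivative (derivative (kummerPoly j b))).eval s
      + (b - s) * (derivative (kummerPoly j b)).eval s + j * (kummerPoly j b).eval s = 0 := by
  have h : X * derivative (derivative (kummerPoly j b))
      + (C b * derivative (kummerPoly j b) - X * derivative (kummerPoly j b))
      + C (j : ℝ) * kummerPoly j b = 0 := by
    ext m
    have hm := kummerPoly_coeff_succ j hb m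
    cases m with
    | zero =>
      simp only [coeff_add, coeff_sub, coeff_C_mul, coeff_derivative, coeff_zero,
        coeff_X_mul_zero]
      push_cast at hm ⊢
      linear_combination hm
    | succ m =>
      simp only [coeff_add, coeff_sub, coeff_C_mul, coeff_derivative, coeff_zero, coeff_X_mul]
      push_cast at hm ⊢
      linear_combination hm
  have := congrArg (eval s) h
  simp only [eval_add, eval_sub, eval_mul, eval_X, eval_C, eval_zero] at this
  linear_combination this

/-- A polynomial times `x ^ c * exp (-x ^ 2 / 4)` is integrable on the half line. -/
theorem integrableOn_rpow_mul_eval_mul_exp {c : ℝ} (hc : -1 < c) (p : Polynomial ℝ) :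
    IntegrableOn (fun x : ℝ => x ^ c * p.eval x * Real.exp (-x ^ 2 / 4)) (Ioi 0) := by
  induction p using Polynomial.induction_on' with
  | add p q hp hq =>
    refine (hp.add hq).congr_fun (fun x _ => ?_) measurableSet_Ioi
    simp only [Pi.add_apply, Polynomial.eval_add]
    ring
  | monomial m a =>
    have hs : -1 < c + m := by linarith [(Nat.cast_nonneg m : (0 : ℝ) ≤ m)]
    have hi : IntegrableOn (fun x : ℝ => a * (x ^ (c + m) * Real.exp (-(1 / 4) * x ^ 2)))
        (Ioi 0) :=
      (integrableOn_rpow_mul_exp_neg_mul_sq (by norm_num) hs).const_mul a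
    refine hi.congr_fun (fun x hx => ?_) measurableSet_Ioi
    simp only [Polynomial.eval_monomial]
    rw [Real.rpow_add hx, Real.rpow_natCast, show -(1 / 4 : ℝ) * x ^ 2 = -x ^ 2 / 4 by ring]
    ring

theorem hasDerivAt_rpow_mul_eval_mul_exp (c : ℝ) (p : Polynomial ℝ) {x : ℝ} (hx : 0 < x) :
    HasDerivAt (fun x : ℝ => x ^ (c + 1) * p.eval x * Real.exp (-x ^ 2 / 4))
      (x ^ c * ((c + 1) * p.eval x + x * p.derivative.eval x - x ^ 2 / 2 * p.eval x)
        * Real.exp (-x ^ 2 / 4)) x := by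
  have h1 : HasDerivAt (fun x : ℝ => x ^ (c + 1)) ((c + 1) * x ^ c) x := by
    simpa using Real.hasDerivAt_rpow_const (p := c + 1) (Or.inl hx.ne')
  have h2 : HasDerivAt (fun x : ℝ => -x ^ 2 / 4) (-x / 2) x := by
    refine (((hasDerivAt_pow 2 x).neg).div_const 4).congr_deriv ?_
    norm_num
    ring
  refine ((h1.mul (p.hasDerivAt x)).mul h2.exp).congr_deriv ?_
  simp only [Pi.mul_apply]
  rw [Real.rpow_add_one hx.ne']
  ring

open Polynomial in
/-- The total derivative of `x ^ (c + 1) * p * exp (-x ^ 2 / 4)` integrates to zero. -/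
theorem integral_deriv_rpow_mul_eval_mul_exp {c : ℝ} (hc : -1 < c) (p : ℝ[X]) :
    ∫ x in Ioi (0 : ℝ),
      x ^ c * ((c + 1) * p.eval x + x * p.derivative.eval x - x ^ 2 / 2 * p.eval x)
        * Real.exp (-x ^ 2 / 4) = 0 := by
  have hd := fun x (hx : x ∈ Ioi (0 : ℝ)) => hasDerivAt_rpow_mul_eval_mul_exp c p hx
  have hi : IntegrableOn (fun x : ℝ =>
      x ^ c * ((c + 1) * p.eval x + x * p.derivative.eval x - x ^ 2 / 2 * p.eval x)
        * Real.exp (-x ^ 2 / 4)) (Ioi 0) := by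
    refine (integrableOn_rpow_mul_eval_mul_exp hc
      (C (c + 1) * p + X * derivative p - C (1 / 2) * X ^ 2 * p)).congr_fun
      (fun x _ => ?_) measurableSet_Ioi
    simp only [eval_add, eval_sub, eval_mul, eval_C, eval_X, eval_pow]
    ring
  have hF := integrableOn_rpow_mul_eval_mul_exp (c := c + 1) (by linarith) p
  have hcont : ContinuousWithinAt
      (fun x : ℝ => x ^ (c + 1) * p.eval x * Real.exp (-x ^ 2 / 4)) (Ici 0) 0 := by
    refine ContinuousAt.continuousWithinAt ?_
    refine ((Real.continuousAt_rpow_const _ _ (Or.inr (by linarith))).mul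
      p.continuous.continuousAt).mul ?_
    fun_prop
  rw [integral_Ioi_of_hasDerivAt_of_tendsto hcont hd hi
    (tendsto_zero_of_hasDerivAt_of_integrableOn_Ioi hd hi hF),
    Real.zero_rpow (by linarith)]
  simp

/-- for every `j ≥ 0` the integrals
`∫₀^∞ (φ_j'² − ((n−2)/x² + 1/2) φ_j²) w` and `∫₀^∞ φ_j² w` converge absolutely, and
the first equals `λ_j` times the second, where `w(x) = x^{n−2} e^{−x²/4}`. -/
theorem stmt_3 (n : ℕ) (hn : 8 ≤ n)
    (α b : ℝ)
    (hα : α = (3 - (n : ℝ) + Real.sqrt ((n : ℝ) ^ 2 - 10 * (n : ℝ) + 17)) / 2)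
    (hb : b = α + ((n : ℝ) - 1) / 2)
    (j : ℕ) (lam : ℝ) (hlam : lam = -(1 - α) / 2 + (j : ℝ))
    (φ w : ℝ → ℝ)
    (hφ : ∀ y : ℝ, φ y = y ^ α * ∑ m ∈ Finset.range (j + 1),
      (-1 : ℝ) ^ m * (j.choose m : ℝ) * (y ^ 2 / 4) ^ m
        / ∏ k ∈ Finset.range m, (b + (k : ℝ)))
    (hw : ∀ y : ℝ, w y = y ^ ((n : ℝ) - 2) * Real.exp (-y ^ 2 / 4)) :
    IntegrableOn
      (fun x => ((deriv φ x) ^ 2 - (((n : ℝ) - 2) / x ^ 2 + 1 / 2) * (φ x) ^ 2) * w x)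
      (Ioi 0) ∧
    IntegrableOn (fun x => (φ x) ^ 2 * w x) (Ioi 0) ∧
    ∫ x in Ioi (0 : ℝ),
        ((deriv φ x) ^ 2 - (((n : ℝ) - 2) / x ^ 2 + 1 / 2) * (φ x) ^ 2) * w x
      = lam * ∫ x in Ioi (0 : ℝ), (φ x) ^ 2 * w x := by
  have hn' : (8 : ℝ) ≤ n := by exact_mod_cast hn
  have hD : 0 < (n : ℝ) ^ 2 - 10 * (n : ℝ) + 17 := by nlinarith
  have hs := Real.sqrt_pos.mpr hD
  have hsq := Real.sq_sqrt hD.le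
  set r := Real.sqrt ((n : ℝ) ^ 2 - 10 * (n : ℝ) + 17)
  have hb0 : 0 < b := by rw [hb, hα]; linarith
  have hαe : α * (α - 1) + ((n : ℝ) - 2) * (α + 1) = 0 := by
    rw [hα]; linear_combination hsq / 4
  set c : ℝ := 2 * α + n - 4 with hc
  have hc1 : -1 < c := by rw [hc, hα]; linarith
  set R : Polynomial ℝ := (kummerPoly j b).comp
    (Polynomial.C (1 / 4) * Polynomial.X ^ 2) with hR
  have hRφ : ∀ y, φ y = y ^ α * R.eval y := by
    intro y
    rw [hφ y, hR, Polynomial.eval_comp, kummerPoly, Polynomial.eval_finsetSum]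
    congr 1
    refine Finset.sum_congr rfl fun m _ => ?_
    simp only [Polynomial.eval_monomial, Polynomial.eval_mul, Polynomial.eval_C,
      Polynomial.eval_pow, Polynomial.eval_X]
    rw [show (1 / 4 : ℝ) * y ^ 2 = y ^ 2 / 4 by ring]
    ring
  have hode : ∀ y, y * R.derivative.derivative.eval y
      + (2 * α + n - 2 - y ^ 2 / 2) * R.derivative.eval y + j * y * R.eval y = 0 := by
    intro y
    have h := kummerPoly_ode j hb0 (1 / 4 * y ^ 2)
    have hq : Polynomial.derivative (Polynomial.C (1 / 4 : ℝ) * Polynomial.X ^ 2) =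
        Polynomial.C (1 / 2) * Polynomial.X := by
      rw [Polynomial.derivative_C_mul, Polynomial.derivative_X_pow, ← mul_assoc,
        ← Polynomial.C_mul]
      norm_num
    have hR1 : R.derivative = Polynomial.C (1 / 2) * Polynomial.X *
        (kummerPoly j b).derivative.comp (Polynomial.C (1 / 4) * Polynomial.X ^ 2) := by
      rw [hR, Polynomial.derivative_comp, hq]
    have hR2 : R.derivative.derivative = Polynomial.C (1 / 2) *
          (kummerPoly j b).derivative.comp (Polynomial.C (1 / 4) * Polynomial.X ^ 2) +
        Polynomial.C (1 / 2) * Polynomial.X * (Polynomial.C (1 / 2) * Polynomial.X *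
          (kummerPoly j b).derivative.derivative.comp
            (Polynomial.C (1 / 4) * Polynomial.X ^ 2)) := by
      rw [hR1, Polynomial.derivative_mul, Polynomial.derivative_C_mul, Polynomial.derivative_X,
        Polynomial.derivative_comp, hq, mul_one]
    rw [hR2, hR1, hR]
    simp only [Polynomial.eval_comp, Polynomial.eval_add, Polynomial.eval_mul,
      Polynomial.eval_C, Polynomial.eval_pow, Polynomial.eval_X]
    rw [hb] at h ⊢
    linear_combination y * h
  have hφ' : ∀ x ∈ Ioi (0 : ℝ), deriv φ x =
      x ^ (α - 1) * (α * R.eval x + x * R.derivative.eval x) := by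
    intro x hx
    have hx0 : (0 : ℝ) < x := hx
    rw [funext hRφ]
    have h := ((Real.hasDerivAt_rpow_const (p := α) (Or.inl hx0.ne')).mul
      (R.hasDerivAt x)).deriv
    refine h.trans ?_
    have : x ^ α = x ^ (α - 1) * x := by
      rw [← Real.rpow_add_one hx0.ne', sub_add_cancel]
    rw [this]
    ring
  have hpow : ∀ x ∈ Ioi (0 : ℝ), x ^ c = (x ^ (α - 1)) ^ 2 * x ^ ((n : ℝ) - 2) := by
    intro x hx
    rw [← Real.rpow_mul_natCast (le_of_lt hx), ← Real.rpow_add hx, hc]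
    congr 1
    push_cast
    ring
  have h1 : ∀ x ∈ Ioi (0 : ℝ),
      ((deriv φ x) ^ 2 - (((n : ℝ) - 2) / x ^ 2 + 1 / 2) * (φ x) ^ 2) * w x =
      x ^ c * ((α * R.eval x + x * R.derivative.eval x) ^ 2
        - ((n : ℝ) - 2 + x ^ 2 / 2) * R.eval x ^ 2) * Real.exp (-x ^ 2 / 4) := by
    intro x hx
    have hx0 : x ≠ 0 := ne_of_gt hx
    have : x ^ α = x ^ (α - 1) * x := by
      rw [← Real.rpow_add_one hx0, sub_add_cancel]
    rw [hφ' x hx, hRφ, hw, hpow x hx, this]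
    field_simp
  have h2 : ∀ x ∈ Ioi (0 : ℝ), (φ x) ^ 2 * w x =
      x ^ c * (x ^ 2 * R.eval x ^ 2) * Real.exp (-x ^ 2 / 4) := by
    intro x hx
    have hx0 : x ≠ 0 := ne_of_gt hx
    have : x ^ α = x ^ (α - 1) * x := by
      rw [← Real.rpow_add_one hx0, sub_add_cancel]
    rw [hRφ, hw, hpow x hx, this]
    ring
  have i1 : IntegrableOn
      (fun x => ((deriv φ x) ^ 2 - (((n : ℝ) - 2) / x ^ 2 + 1 / 2) * (φ x) ^ 2) * w x)
      (Ioi 0) := by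
    refine (integrableOn_rpow_mul_eval_mul_exp hc1
      ((Polynomial.C α * R + Polynomial.X * R.derivative) ^ 2
        - (Polynomial.C ((n : ℝ) - 2) + Polynomial.C (1 / 2) * Polynomial.X ^ 2)
          * R ^ 2)).congr_fun (fun x hx => ?_) measurableSet_Ioi
    rw [h1 x hx]
    simp only [Polynomial.eval_add, Polynomial.eval_sub, Polynomial.eval_mul,
      Polynomial.eval_C, Polynomial.eval_X, Polynomial.eval_pow]
    ring
  have i2 : IntegrableOn (fun x => (φ x) ^ 2 * w x) (Ioi 0) := by
    refine (integrableOn_rpow_mul_eval_mul_exp hc1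
      (Polynomial.X ^ 2 * R ^ 2)).congr_fun (fun x hx => ?_) measurableSet_Ioi
    rw [h2 x hx]
    simp only [Polynomial.eval_mul, Polynomial.eval_X, Polynomial.eval_pow]
  refine ⟨i1, i2, ?_⟩
  rw [← sub_eq_zero, ← integral_const_mul, ← integral_sub i1 (i2.const_mul lam)]
  refine Eq.trans ?_ (integral_deriv_rpow_mul_eval_mul_exp hc1
    (R * (Polynomial.C α * R + Polynomial.X * R.derivative)))
  refine setIntegral_congr_fun measurableSet_Ioi fun x hx => ?_
  simp only [h1 x hx, h2 x hx, Polynomial.derivative_mul, Polynomial.derivative_add,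
    Polynomial.derivative_C, Polynomial.derivative_X, Polynomial.eval_add, Polynomial.eval_mul,
    Polynomial.eval_C, Polynomial.eval_X, Polynomial.eval_zero, Polynomial.eval_one]
  rw [hlam, hc]
  linear_combination (-x ^ (2 * α + n - 4) * Real.exp (-x ^ 2 / 4)) *
    (x * R.eval x * hode x + R.eval x ^ 2 * hαe)
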